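/- arXiv:1909.11156 — 4 statements merged into one kernel-verified Lean document; each statement's English description precedes it below -/
import Mathlib

section
/- For each n ≥ 1, let F_n be a 2^n-ary de Bruijn sequence of order n (a sequence of length 2^{n²} over the alphabet {0, 1, ..., 2^n−1}), let A_n be the finite sequence of length 2^{n²} obtained by dividing each term of F_n by 2^n, let B_n be the concatenation of n·2^{2n} consecutive copies of A_n, and let K be the infinite sequence of real numbers obtained by concatenating B_1, B_2, B_3, .... Then K is completely uniformly distributed: for every integer k ≥ 1 and every box I = [u_1, v_1) × ... × [u_k, v_k) ⊆ [0,1)^k, the proportion (1/N) · #{ i ∈ {1,...,N} : (K_i, K_{i+1}, ..., K_{i+k−1}) ∈ I } converges, as N → ∞, to the measure (v_1 − u_1)···(v_k − u_k) of I. -/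
/-- `f` is a `b`-ary de Bruijn sequence of order `n`: a sequence of length `b ^ n`
over the alphabet `{0, 1, ..., b - 1}` such that, viewed cyclically, every `b`-ary
word of length `n` occurs exactly once among its cyclic windows. -/
def IsDeBruijn (b n : ℕ) (f : ℕ → ℕ) : Prop :=
  (∀ i, i < b ^ n → f i < b) ∧
  ∀ w : Fin n → ℕ, (∀ d, w d < b) →
    ((Finset.range (b ^ n)).filter
      (fun i => ∀ d : Fin n, f ((i + d.val) % b ^ n) = w d)).card = 1

open Filter Topology

/-- Among the cyclic windows of a de Bruijn sequence of order `k + m`, those whose first `k`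
letters lie in prescribed sets are counted by the product of the sizes of these sets. -/
theorem IsDeBruijn.card_windows_mem {b k m : ℕ} {f : ℕ → ℕ} (hf : IsDeBruijn b (k + m) f)
    (hb : 0 < b) (T : Fin k → Finset ℕ) (hT : ∀ d, T d ⊆ Finset.range b) :
    ((Finset.range (b ^ (k + m))).filter
      (fun i => ∀ d : Fin k, f ((i + d.val) % b ^ (k + m)) ∈ T d)).card
      = (∏ d, (T d).card) * b ^ m := by
  obtain ⟨hlt, hone⟩ := hf
  have hpos : 0 < b ^ (k + m) := pow_pos hb _
  let W : Finset (Fin (k + m) → ℕ) :=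
    Fintype.piFinset (Fin.addCases T (fun _ : Fin m => Finset.range b))
  have hW : ∀ w, w ∈ W ↔
      (∀ d : Fin k, w (Fin.castAdd m d) ∈ T d) ∧ ∀ d : Fin m, w (Fin.natAdd k d) < b := by
    intro w
    simp only [W, Fintype.mem_piFinset]
    constructor
    · intro h
      refine ⟨fun d => ?_, fun d => ?_⟩
      · simpa using h (Fin.castAdd m d)
      · simpa using h (Fin.natAdd k d)
    · rintro ⟨h1, h2⟩ d
      refine Fin.addCases (fun d => ?_) (fun d => ?_) d
      · simpa using h1 d
      · simpa using h2 d
  have hcard : W.card = (∏ d, (T d).card) * b ^ m := by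
    simp [W, Fintype.card_piFinset, Fin.prod_univ_add]
  rw [← hcard]
  refine Finset.card_bij (fun i _ d => f ((i + d.val) % b ^ (k + m))) ?_ ?_ ?_
  · intro i hi
    rw [hW]
    refine ⟨fun d => ?_, fun d => hlt _ (Nat.mod_lt _ hpos)⟩
    simpa using (Finset.mem_filter.1 hi).2 d
  · intro i hi j hj hij
    have h1 := Finset.card_le_one.1
      (hone (fun d => f ((i + d.val) % b ^ (k + m))) fun d => hlt _ (Nat.mod_lt _ hpos)).le
    refine h1 i ?_ j ?_
    · simpa using (Finset.mem_filter.1 hi).1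
    · refine Finset.mem_filter.2 ⟨(Finset.mem_filter.1 hj).1, fun d => ?_⟩
      exact (congrFun hij d).symm
  · intro w hw
    have hw' := (hW w).1 hw
    have hwb : ∀ d, w d < b := fun d =>
      Fin.addCases (fun d => Finset.mem_range.1 (hT d (hw'.1 d))) hw'.2 d
    obtain ⟨i, hi⟩ := Finset.card_pos.1 (by rw [hone w hwb]; exact one_pos)
    obtain ⟨hi1, hi2⟩ := Finset.mem_filter.1 hi
    refine ⟨i, Finset.mem_filter.2 ⟨hi1, fun d => ?_⟩, funext hi2⟩
    have := hi2 (Fin.castAdd m d)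
    simp only [Fin.val_castAdd] at this
    rw [this]
    exact hw'.1 d

/-- The number of grid points `x / b`, `x < b`, in `[u, v)`. -/
theorem card_filter_div_mem_Ico (b : ℕ) (hb : 0 < b) (u v : ℝ) (huv : u ≤ v)
    (hv : v ≤ 1) :
    (((Finset.range b).filter (fun x : ℕ => u ≤ (x : ℝ) / b ∧ (x : ℝ) / b < v)).card : ℝ)
      = (⌈v * b⌉₊ : ℝ) - ⌈u * b⌉₊ := by
  have hb' : (0 : ℝ) < b := by exact_mod_cast hb
  have h : (Finset.range b).filter (fun x : ℕ => u ≤ (x : ℝ) / b ∧ (x : ℝ) / b < v)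
      = Finset.Ico ⌈u * b⌉₊ ⌈v * b⌉₊ := by
    ext x
    simp only [Finset.mem_filter, Finset.mem_range, Finset.mem_Ico, Nat.ceil_le, Nat.lt_ceil,
      le_div_iff₀ hb', div_lt_iff₀ hb']
    refine ⟨fun h => h.2, fun h => ⟨?_, h⟩⟩
    have : (x : ℝ) < b := by nlinarith [h.2]
    exact_mod_cast this
  rw [h, Nat.card_Ico, Nat.cast_sub (Nat.ceil_mono (by gcongr))]

/-- The proportion of cyclic windows of de Bruijn sequences of order `n ≥ k` over growing
alphabets that fall in a fixed box tends to the measure of the box. -/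
theorem tendsto_card_deBruijn_windows (F : ℕ → ℕ → ℕ)
    (hF : ∀ n, 1 ≤ n → IsDeBruijn (2 ^ n) n (F n)) (k : ℕ) (hk : 1 ≤ k) (u v : Fin k → ℝ)
    (hu : ∀ d, 0 ≤ u d) (huv : ∀ d, u d ≤ v d) (hv : ∀ d, v d ≤ 1) :
    Tendsto (fun n => (((Finset.range ((2 ^ n) ^ n)).filter (fun i => ∀ d : Fin k,
        u d ≤ (F n ((i + d.val) % (2 ^ n) ^ n) : ℝ) / 2 ^ n ∧
          (F n ((i + d.val) % (2 ^ n) ^ n) : ℝ) / 2 ^ n < v d)).card : ℝ) / (2 ^ n) ^ n)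
      atTop (𝓝 (∏ d, (v d - u d))) := by
  have hpow : Tendsto (fun n : ℕ => (2 : ℝ) ^ n) atTop atTop :=
    tendsto_pow_atTop_atTop_of_one_lt one_lt_two
  have hlim : Tendsto (fun n : ℕ => ∏ d : Fin k,
      ((⌈v d * (2 : ℝ) ^ n⌉₊ : ℝ) / 2 ^ n - (⌈u d * (2 : ℝ) ^ n⌉₊ : ℝ) / 2 ^ n))
      atTop (𝓝 (∏ d, (v d - u d))) :=
    tendsto_finsetProd _ fun d _ =>
      ((tendsto_nat_ceil_mul_div_atTop ((hu d).trans (huv d))).comp hpow).sub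
        ((tendsto_nat_ceil_mul_div_atTop (hu d)).comp hpow)
  refine hlim.congr' ?_
  filter_upwards [eventually_ge_atTop k] with n hn
  have key : ∀ b m : ℕ, 0 < b → ∀ f, IsDeBruijn b (k + m) f →
      ∏ d : Fin k, ((⌈v d * (b : ℝ)⌉₊ : ℝ) / b - (⌈u d * (b : ℝ)⌉₊ : ℝ) / b) =
      (((Finset.range (b ^ (k + m))).filter (fun i => ∀ d : Fin k,
        u d ≤ (f ((i + d.val) % b ^ (k + m)) : ℝ) / b ∧
          (f ((i + d.val) % b ^ (k + m)) : ℝ) / b < v d)).card : ℝ) / (b : ℝ) ^ (k + m) := by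
    intro b m hb f hf
    have hb' : (b : ℝ) ≠ 0 := by exact_mod_cast hb.ne'
    have h := hf.card_windows_mem hb
      (fun d => (Finset.range b).filter (fun x : ℕ => u d ≤ (x : ℝ) / b ∧ (x : ℝ) / b < v d))
      (fun d => Finset.filter_subset _ _)
    have hlt : ∀ i, f (i % b ^ (k + m)) < b := fun i =>
      hf.1 _ (Nat.mod_lt _ (pow_pos hb _))
    simp only [Finset.mem_filter, Finset.mem_range, hlt, true_and] at h
    rw [h]
    push_cast
    simp_rw [card_filter_div_mem_Ico b hb _ _ (huv _) (hv _)]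
    simp_rw [← sub_div]
    rw [Finset.prod_div_distrib, Finset.prod_const, Finset.card_univ, Fintype.card_fin, pow_add]
    exact (mul_div_mul_right _ _ (pow_ne_zero _ hb')).symm
  obtain ⟨m, hm⟩ := Nat.exists_eq_add_of_le hn
  have h := key (2 ^ n) m (by positivity) (F n) (by rw [← hm]; exact hF n (hk.trans hn))
  rw [← hm] at h
  push_cast at h
  exact h

/-- Two predicates agreeing on the first `L - k` numbers have counts below `L` differing by at
most `k`. -/
theorem abs_count_sub_count_le (p q : ℕ → Prop) [DecidablePred p] [DecidablePred q] (k L : ℕ)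
    (h : ∀ i, i + k ≤ L → (p i ↔ q i)) :
    |(Nat.count p L : ℝ) - Nat.count q L| ≤ k := by
  rcases le_total L k with hL | hL
  · have h1 : (Nat.count p L : ℝ) ≤ L := by exact_mod_cast Nat.count_le _
    have h2 : (Nat.count q L : ℝ) ≤ L := by exact_mod_cast Nat.count_le _
    have h3 : (L : ℝ) ≤ k := by exact_mod_cast hL
    have h4 : (0 : ℝ) ≤ Nat.count p L := Nat.cast_nonneg _
    have h5 : (0 : ℝ) ≤ Nat.count q L := Nat.cast_nonneg _
    rw [abs_le]
    constructor <;> linarith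
  · obtain ⟨M, rfl⟩ := Nat.exists_eq_add_of_le' hL
    have hM : Nat.count p M = Nat.count q M := by
      rw [Nat.count_eq_card_filter_range, Nat.count_eq_card_filter_range]
      congr 1
      refine Finset.filter_congr fun i hi => h i ?_
      have := Finset.mem_range.1 hi
      omega
    rw [Nat.count_add, Nat.count_add, hM]
    have h1 : (Nat.count (fun i => p (M + i)) k : ℝ) ≤ k := by exact_mod_cast Nat.count_le _
    have h2 : (Nat.count (fun i => q (M + i)) k : ℝ) ≤ k := by exact_mod_cast Nat.count_le _
    have h4 : (0 : ℝ) ≤ Nat.count (fun i => p (M + i)) k := Nat.cast_nonneg _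
    have h5 : (0 : ℝ) ≤ Nat.count (fun i => q (M + i)) k := Nat.cast_nonneg _
    push_cast
    rw [abs_le]
    constructor <;> linarith

/-- A `1`-Lipschitz discrepancy `D` with small increments over the pieces of a block
decomposition, in which pieces are short compared with their position, is sublinear. -/
theorem tendsto_div_zero_of_blocks (D : ℕ → ℝ) (S m L : ℕ → ℕ)
    (hD : ∀ N r, |D (N + r) - D N| ≤ r)
    (hL : ∀ n, 0 < L n) (hm : ∀ n, 1 ≤ n → 0 < m n)
    (hS : ∀ n, 1 ≤ n → S (n + 1) = S n + m n * L n)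
    (hLS : ∀ ε : ℝ, 0 < ε → ∀ᶠ n in atTop, (L n : ℝ) ≤ ε * S n)
    (hinc : ∀ ε : ℝ, 0 < ε → ∀ᶠ n in atTop, ∀ j, j < m n →
      |D (S n + j * L n + L n) - D (S n + j * L n)| ≤ ε * L n) :
    Tendsto (fun N => D N / N) atTop (𝓝 0) := by
  rw [Metric.tendsto_atTop]
  intro ε hε
  set δ := ε / 4 with hδ
  have hδ0 : 0 < δ := by positivity
  obtain ⟨n₀, hn₀⟩ := eventually_atTop.1
    ((hLS δ hδ0).and ((hinc δ hδ0).and (eventually_ge_atTop 1)))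
  have hn₁ : 1 ≤ n₀ := (hn₀ n₀ le_rfl).2.2
  have hinner : ∀ n, n₀ ≤ n → |D (S n)| ≤ |D (S n₀)| + δ * S n → ∀ j, j ≤ m n →
      |D (S n + j * L n)| ≤ |D (S n₀)| + δ * ((S n + j * L n : ℕ) : ℝ) := by
    intro n hn h0 j
    induction j with
    | zero => intro _; simpa using h0
    | succ j ih =>
      intro hj
      have h1 := ih (by omega)
      have h2 := (hn₀ n hn).2.1 j (by omega)
      have h3 : S n + (j + 1) * L n = S n + j * L n + L n := by ring
      rw [h3]
      have h4 := abs_sub_abs_le_abs_sub (D (S n + j * L n + L n)) (D (S n + j * L n))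
      push_cast at h1 ⊢
      linarith
  have hstart : ∀ n, n₀ ≤ n → |D (S n)| ≤ |D (S n₀)| + δ * S n := by
    intro n hn
    induction n, hn using Nat.le_induction with
    | base => have : 0 ≤ δ * (S n₀ : ℝ) := by positivity
              linarith
    | succ n hn ih =>
      rw [hS n (hn₁.trans hn)]
      exact hinner n hn ih (m n) le_rfl
  have hfind : ∀ N, S n₀ ≤ N → ∃ n, n₀ ≤ n ∧ S n ≤ N ∧ N < S (n + 1) := by
    have hlt : ∀ n, n₀ ≤ n → S n < S (n + 1) := by
      intro n hn
      rw [hS n (hn₁.trans hn)]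
      have := Nat.mul_pos (hm n (hn₁.trans hn)) (hL n)
      omega
    intro N hN
    induction N, hN using Nat.le_induction with
    | base => exact ⟨n₀, le_rfl, le_rfl, hlt n₀ le_rfl⟩
    | succ N hN ih =>
      obtain ⟨n, h1, h2, h3⟩ := ih
      rcases Nat.lt_or_ge (N + 1) (S (n + 1)) with h | h
      · exact ⟨n, h1, by omega, h⟩
      · exact ⟨n + 1, by omega, h, by have := hlt (n + 1) (by omega); omega⟩
  have hbound : ∀ N, S n₀ ≤ N → |D N| ≤ |D (S n₀)| + 2 * δ * N := by
    intro N hN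
    obtain ⟨n, h1, h2, h3⟩ := hfind N hN
    obtain ⟨t, rfl⟩ := Nat.exists_eq_add_of_le h2
    have hq : t / L n < m n := by
      rw [Nat.div_lt_iff_lt_mul (hL n)]
      rw [hS n (hn₁.trans h1)] at h3
      omega
    have h4 := hinner n h1 (hstart n h1) (t / L n) hq.le
    have h5 := hD (S n + t / L n * L n) (t % L n)
    have h6 : S n + t / L n * L n + t % L n = S n + t := by
      rw [add_assoc, Nat.div_add_mod']
    rw [h6] at h5
    have h7 : ((t % L n : ℕ) : ℝ) ≤ L n := by exact_mod_cast (Nat.mod_lt _ (hL n)).le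
    have h8 := (hn₀ n h1).1
    have h9 := abs_sub_abs_le_abs_sub (D (S n + t)) (D (S n + t / L n * L n))
    have h10 : ((S n + t / L n * L n : ℕ) : ℝ) ≤ ((S n + t : ℕ) : ℝ) := by
      exact_mod_cast (by omega : S n + t / L n * L n ≤ S n + t)
    have h11 : (S n : ℝ) ≤ ((S n + t : ℕ) : ℝ) := by exact_mod_cast Nat.le_add_right _ _
    have h12 := mul_le_mul_of_nonneg_left h10 hδ0.le
    have h13 := mul_le_mul_of_nonneg_left h11 hδ0.le
    linarith
  obtain ⟨N₁, hN₁⟩ := exists_nat_gt (|D (S n₀)| / δ)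
  refine ⟨max (S n₀) (N₁ + 1), fun N hN => ?_⟩
  have hNS : S n₀ ≤ N := (le_max_left _ _).trans hN
  have hNN : N₁ + 1 ≤ N := (le_max_right _ _).trans hN
  have hN0 : (0 : ℝ) < N := by exact_mod_cast (by omega : 0 < N)
  have hN1 : (N₁ : ℝ) ≤ N := by exact_mod_cast (by omega : N₁ ≤ N)
  have h1 := hbound N hNS
  have h2 : |D (S n₀)| < δ * N := by
    rw [div_lt_iff₀ hδ0] at hN₁
    nlinarith
  rw [Real.dist_eq, sub_zero, abs_div, Nat.abs_cast, div_lt_iff₀ hN0]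
  nlinarith

/-- The period of each block is short compared with the total length of the preceding blocks. -/
theorem eventually_period_le (ε : ℝ) (hε : 0 < ε) :
    ∀ᶠ n : ℕ in atTop, (((2 ^ n) ^ n : ℕ) : ℝ) ≤
      ε * ((∑ s ∈ Finset.Ico 1 n, s * 2 ^ (2 * s) * (2 ^ s) ^ s : ℕ) : ℝ) := by
  obtain ⟨M, hM⟩ := exists_nat_gt (2 / ε)
  filter_upwards [eventually_ge_atTop (M + 2)] with n hn
  obtain ⟨p, rfl⟩ : ∃ p, n = p + 1 := ⟨n - 1, by omega⟩
  rw [Finset.sum_Ico_succ_top (by omega)]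
  have h1 : (2 ^ (p + 1)) ^ (p + 1) = 2 * (2 ^ (2 * p) * (2 ^ p) ^ p) := by
    ring
  have hp : (M : ℝ) ≤ p := by exact_mod_cast (by omega : M ≤ p)
  have h2 : 2 ≤ ε * p := by
    rw [div_lt_iff₀ hε] at hM
    nlinarith
  rw [h1]
  push_cast
  have h3 : (0 : ℝ) ≤ ∑ s ∈ Finset.Ico 1 p, (s : ℝ) * 2 ^ (2 * s) * (2 ^ s) ^ s := by positivity
  have h4 : (0 : ℝ) ≤ 2 ^ (2 * p) * (2 ^ p) ^ p := by positivity
  have h5 := mul_le_mul_of_nonneg_right h2 h4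
  have h6 := mul_nonneg hε.le h3
  linarith

theorem stmt1 (F : ℕ → ℕ → ℕ) (hF : ∀ n, 1 ≤ n → IsDeBruijn (2 ^ n) n (F n))
    (K : ℕ → ℝ)
    -- `K` is the concatenation, for n = 1, 2, 3, ..., of n * 2^(2n) consecutive copies
    -- of the sequence A_n of length (2^n)^n = 2^(n^2) whose i-th term is F_n(i) / 2^n.
    (hK : ∀ n, 1 ≤ n → ∀ j, j < n * 2 ^ (2 * n) → ∀ i, i < (2 ^ n) ^ n →
      K ((∑ s ∈ Finset.Ico 1 n, s * 2 ^ (2 * s) * (2 ^ s) ^ s) + j * (2 ^ n) ^ n + i)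
        = (F n i : ℝ) / 2 ^ n)
    (k : ℕ) (hk : 1 ≤ k) (u v : Fin k → ℝ)
    (hu : ∀ d, 0 ≤ u d) (huv : ∀ d, u d ≤ v d) (hv : ∀ d, v d ≤ 1) :
    Filter.Tendsto (fun N => (((Finset.range N).filter
        (fun i => ∀ d : Fin k, u d ≤ K (i + d.val) ∧ K (i + d.val) < v d)).card : ℝ) / N)
      Filter.atTop (nhds (∏ d, (v d - u d))) := by
  have hcyc := tendsto_card_deBruijn_windows F hF k hk u v hu huv hv
  simp_rw [← Nat.count_eq_card_filter_range] at hcyc ⊢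
  set a := ∏ d, (v d - u d) with ha
  have ha0 : 0 ≤ a := Finset.prod_nonneg fun d _ => sub_nonneg.2 (huv d)
  have ha1 : a ≤ 1 := Finset.prod_le_one (fun d _ => sub_nonneg.2 (huv d))
    fun d _ => by linarith [hu d, hv d]
  have hmain := tendsto_div_zero_of_blocks
    (fun N => (Nat.count (fun i => ∀ d : Fin k, u d ≤ K (i + d.val) ∧ K (i + d.val) < v d) N : ℝ)
      - a * N)
    (fun n => ∑ s ∈ Finset.Ico 1 n, s * 2 ^ (2 * s) * (2 ^ s) ^ s)
    (fun n => n * 2 ^ (2 * n)) (fun n => (2 ^ n) ^ n) ?_ (fun n => by positivity)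
    (fun n hn => by positivity) (fun n hn => Finset.sum_Ico_succ_top hn _) eventually_period_le ?_
  · have h := hmain.add_const a
    rw [zero_add] at h
    refine h.congr' ?_
    filter_upwards [eventually_gt_atTop 0] with N hN
    have hN' : (N : ℝ) ≠ 0 := by exact_mod_cast hN.ne'
    field_simp
    ring
  · intro N r
    rw [Nat.count_add]
    push_cast
    set c := Nat.count (fun i => ∀ d : Fin k, u d ≤ K (N + i + d.val) ∧ K (N + i + d.val) < v d) r
    have hc : (c : ℝ) ≤ r := by exact_mod_cast Nat.count_le _
    have hc0 : (0 : ℝ) ≤ c := Nat.cast_nonneg _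
    have hr0 : (0 : ℝ) ≤ r := Nat.cast_nonneg _
    rw [abs_le]
    constructor <;> nlinarith
  · intro ε hε
    have hlen : Tendsto (fun n : ℕ => (((2 : ℝ) ^ n) ^ n)) atTop atTop := by
      refine tendsto_atTop_mono' _ ?_ (tendsto_pow_atTop_atTop_of_one_lt (one_lt_two (α := ℝ)))
      filter_upwards [eventually_ge_atTop 1] with n hn
      exact le_self_pow₀ (one_le_pow₀ one_le_two) (by omega)
    filter_upwards [eventually_ge_atTop 1, hlen.eventually_ge_atTop (k / (ε / 2)),
      (Metric.tendsto_nhds.1 hcyc) (ε / 2) (by positivity)] with n hn hkn hdist j hj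
    rw [Nat.count_add]
    have hL : (0 : ℝ) < ((2 : ℝ) ^ n) ^ n := by positivity
    rw [div_le_iff₀ (by positivity)] at hkn
    rw [Real.dist_eq] at hdist
    have habs := abs_count_sub_count_le
      (fun i => ∀ d : Fin k,
        u d ≤ K ((∑ s ∈ Finset.Ico 1 n, s * 2 ^ (2 * s) * (2 ^ s) ^ s) + j * (2 ^ n) ^ n + i
            + d.val) ∧
          K ((∑ s ∈ Finset.Ico 1 n, s * 2 ^ (2 * s) * (2 ^ s) ^ s) + j * (2 ^ n) ^ n + i
            + d.val) < v d)
      (fun i => ∀ d : Fin k, u d ≤ (F n ((i + d.val) % (2 ^ n) ^ n) : ℝ) / 2 ^ n ∧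
          (F n ((i + d.val) % (2 ^ n) ^ n) : ℝ) / 2 ^ n < v d) k ((2 ^ n) ^ n) (by
        intro i hi
        refine forall_congr' fun d => ?_
        have hid : i + d.val < (2 ^ n) ^ n := by omega
        rw [add_assoc _ i, hK n hn j hj _ hid, Nat.mod_eq_of_lt hid])
    set c := Nat.count (fun i => ∀ d : Fin k,
        u d ≤ K ((∑ s ∈ Finset.Ico 1 n, s * 2 ^ (2 * s) * (2 ^ s) ^ s) + j * (2 ^ n) ^ n + i
            + d.val) ∧
          K ((∑ s ∈ Finset.Ico 1 n, s * 2 ^ (2 * s) * (2 ^ s) ^ s) + j * (2 ^ n) ^ n + i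
            + d.val) < v d) ((2 ^ n) ^ n)
    set c' := Nat.count (fun i => ∀ d : Fin k,
        u d ≤ (F n ((i + d.val) % (2 ^ n) ^ n) : ℝ) / 2 ^ n ∧
          (F n ((i + d.val) % (2 ^ n) ^ n) : ℝ) / 2 ^ n < v d) ((2 ^ n) ^ n)
    have h1 : |(c' : ℝ) - a * (2 ^ n) ^ n| ≤ ε / 2 * (2 ^ n) ^ n := by
      have : (c' : ℝ) - a * (2 ^ n) ^ n = ((c' : ℝ) / (2 ^ n) ^ n - a) * (2 ^ n) ^ n := by
        field_simp
      rw [this, abs_mul, abs_of_pos hL]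
      gcongr
    have h2 := abs_sub_le (c : ℝ) c' (a * (2 ^ n) ^ n)
    push_cast
    refine le_trans (le_of_eq ?_) (h2.trans ((add_le_add habs h1).trans ?_))
    · congr 1
      ring
    · linarith
end

section
/- Let k be a positive integer, let I = [u_1, v_1) × ... × [u_k, v_k) be a box contained in [0,1)^k, and let n be an integer with k ≤ n. Let F be an n-ary de Bruijn sequence of order n, viewed as a cyclic sequence of length n^n, and let C be the sequence obtained by dividing each term of F by n. Then the number of indices i ∈ {1, ..., n^n} such that the cyclic window (C_i, C_{i+1}, ..., C_{i+k−1}) (indices modulo n^n) lies in I equals n^n·|I| + n^{n−1}·(2^k − 1)·ε for some real ε with −1 < ε < 1, where |I| = ∏_{d=1}^{k} (v_d − u_d). -/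
/-- Windows of length `k` of a de Bruijn sequence of order `k + j` are equidistributed:
each one occurs exactly `b ^ j` times. -/
theorem IsDeBruijn.card_filter_window_mem {b k j : ℕ} {f : ℕ → ℕ} (hf : IsDeBruijn b (k + j) f)
    (S : Fin k → Finset ℕ) (hS : ∀ d, S d ⊆ Finset.range b) :
    ((Finset.range (b ^ (k + j))).filter
      (fun i => ∀ d : Fin k, f ((i + d.val) % b ^ (k + j)) ∈ S d)).card =
      b ^ j * ∏ d, (S d).card := by
  obtain ⟨hlt, hone⟩ := hf
  have hwin : ∀ i, i < b ^ (k + j) → ∀ d : Fin (k + j), f ((i + d.val) % b ^ (k + j)) < b :=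
    fun i hi d => hlt _ (Nat.mod_lt _ (by omega))
  have hcard : (Fintype.piFinset
      (Fin.append S (fun _ : Fin j => Finset.range b))).card = b ^ j * ∏ d, (S d).card := by
    simp [Fintype.card_piFinset, Fin.prod_univ_add, mul_comm]
  rw [← hcard]
  refine Finset.card_bij (fun i _ (d : Fin (k + j)) => f ((i + d.val) % b ^ (k + j))) ?_ ?_ ?_
  · intro i hi
    rw [Finset.mem_filter, Finset.mem_range] at hi
    rw [Fintype.mem_piFinset]
    intro d
    induction d using Fin.addCases with
    | left d => simpa using hi.2 d
    | right d => simpa using hwin i hi.1 (Fin.natAdd k d)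
  · intro i hi i' hi' h
    rw [Finset.mem_filter, Finset.mem_range] at hi hi'
    refine Finset.card_le_one.1 (hone _ (hwin i hi.1)).le i ?_ i' ?_
    · simp [hi.1]
    · simpa [hi'.1] using fun d => (congrFun h d).symm
  · intro w hw
    rw [Fintype.mem_piFinset] at hw
    have hwb : ∀ d, w d < b := by
      intro d
      induction d using Fin.addCases with
      | left d => exact Finset.mem_range.1 (hS d (by simpa using hw (Fin.castAdd j d)))
      | right d => simpa using hw (Fin.natAdd k d)
    obtain ⟨i, hi⟩ := Finset.card_pos.1 ((hone w hwb).symm ▸ Nat.one_pos)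
    rw [Finset.mem_filter] at hi
    refine ⟨i, Finset.mem_filter.2 ⟨hi.1, fun d => ?_⟩, funext hi.2⟩
    have h := hw (Fin.castAdd j d)
    rw [← hi.2] at h
    simpa using h

theorem abs_prod_sub_prod_le_sum {ι : Type*} (s : Finset ι) (x y : ι → ℝ)
    (hx : ∀ i, 0 ≤ x i ∧ x i ≤ 1) (hy : ∀ i, 0 ≤ y i ∧ y i ≤ 1) :
    |∏ i ∈ s, x i - ∏ i ∈ s, y i| ≤ ∑ i ∈ s, |x i - y i| := by
  classical
  induction s using Finset.induction_on with
  | empty => simp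
  | insert a s ha ih =>
    rw [Finset.prod_insert ha, Finset.prod_insert ha, Finset.sum_insert ha]
    have hp0 : 0 ≤ ∏ i ∈ s, x i := Finset.prod_nonneg fun i _ => (hx i).1
    have hp1 : ∏ i ∈ s, x i ≤ 1 := Finset.prod_le_one (fun i _ => (hx i).1) fun i _ => (hx i).2
    calc |x a * ∏ i ∈ s, x i - y a * ∏ i ∈ s, y i|
        = |(x a - y a) * ∏ i ∈ s, x i + y a * (∏ i ∈ s, x i - ∏ i ∈ s, y i)| := by ring_nf
      _ ≤ |x a - y a| * ∏ i ∈ s, x i + y a * |∏ i ∈ s, x i - ∏ i ∈ s, y i| := by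
        refine (abs_add_le _ _).trans_eq ?_
        rw [abs_mul, abs_mul, abs_of_nonneg hp0, abs_of_nonneg (hy a).1]
      _ ≤ |x a - y a| + ∑ i ∈ s, |x i - y i| :=
        add_le_add (mul_le_of_le_one_right (abs_nonneg _) hp1)
          ((mul_le_of_le_one_left (abs_nonneg _) (hy a).2).trans ih)

theorem abs_card_filter_div_sub_lt {n : ℕ} (hn : 0 < n) {u v : ℝ} (hu : 0 ≤ u) (huv : u ≤ v)
    (hv : v ≤ 1) :
    |(((Finset.range n).filter (fun a : ℕ => u ≤ (a : ℝ) / n ∧ (a : ℝ) / n < v)).card : ℝ) / n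
      - (v - u)| < 1 / n := by
  have hn' : (0 : ℝ) < n := by exact_mod_cast hn
  have hset : (Finset.range n).filter (fun a : ℕ => u ≤ (a : ℝ) / n ∧ (a : ℝ) / n < v) =
      Finset.Ico ⌈u * n⌉₊ ⌈v * n⌉₊ := by
    ext a
    simp only [Finset.mem_filter, Finset.mem_range, Finset.mem_Ico, Nat.ceil_le, Nat.lt_ceil,
      le_div_iff₀ hn', div_lt_iff₀ hn', and_iff_right_iff_imp]
    rintro ⟨-, h⟩
    have : (a : ℝ) < n := h.trans_le (mul_le_of_le_one_left hn'.le hv)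
    exact_mod_cast this
  have hle : u * n ≤ v * n := mul_le_mul_of_nonneg_right huv hn'.le
  have hu0 : 0 ≤ u * n := mul_nonneg hu hn'.le
  have hu1 := Nat.le_ceil (u * n)
  have hu2 := Nat.ceil_lt_add_one hu0
  have hv1 := Nat.le_ceil (v * n)
  have hv2 := Nat.ceil_lt_add_one (hu0.trans hle)
  rw [hset, Nat.card_Ico, Nat.cast_sub (Nat.ceil_mono hle), div_sub' hn'.ne', abs_div,
    abs_of_pos hn', div_lt_div_iff_of_pos_right hn', abs_lt]
  constructor <;> linarith

theorem stmt5 (k : ℕ) (hk : 1 ≤ k) (u v : Fin k → ℝ)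
    (hu : ∀ d, 0 ≤ u d) (huv : ∀ d, u d ≤ v d) (hv : ∀ d, v d ≤ 1)
    (n : ℕ) (hkn : k ≤ n) (F : ℕ → ℕ) (hF : IsDeBruijn n n F) :
    ∃ ε : ℝ, -1 < ε ∧ ε < 1 ∧
      (((Finset.range (n ^ n)).filter (fun i => ∀ d : Fin k,
          u d ≤ (F ((i + d.val) % n ^ n) : ℝ) / n ∧
            (F ((i + d.val) % n ^ n) : ℝ) / n < v d)).card : ℝ)
        = n ^ n * (∏ d, (v d - u d)) + n ^ (n - 1) * (2 ^ k - 1) * ε := by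
  have hn : 0 < n := by omega
  have hn' : (0 : ℝ) < n := by exact_mod_cast hn
  let S : Fin k → Finset ℕ := fun d =>
    (Finset.range n).filter (fun a : ℕ => u d ≤ (a : ℝ) / n ∧ (a : ℝ) / n < v d)
  have hcount : ((Finset.range (n ^ n)).filter (fun i => ∀ d : Fin k,
      u d ≤ (F ((i + d.val) % n ^ n) : ℝ) / n ∧
        (F ((i + d.val) % n ^ n) : ℝ) / n < v d)).card = n ^ (n - k) * ∏ d, (S d).card := by
    have hF' : IsDeBruijn n (k + (n - k)) F := by rwa [Nat.add_sub_cancel' hkn]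
    have h := hF'.card_filter_window_mem S fun d => Finset.filter_subset _ _
    rw [Nat.add_sub_cancel' hkn] at h
    rw [← h]
    congr 1
    refine Finset.filter_congr fun i _ => forall_congr' fun d => ?_
    have hlt : F ((i + d.val) % n ^ n) < n := hF.1 _ (Nat.mod_lt _ (by positivity))
    simp [S, hlt]
  have hprod : ((n ^ (n - k) * ∏ d, (S d).card : ℕ) : ℝ) =
      n ^ n * ∏ d, ((S d).card : ℝ) / n := by
    rw [Finset.prod_div_distrib, Finset.prod_const, Finset.card_univ, Fintype.card_fin,
      ← pow_sub_mul_pow (n : ℝ) hkn]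
    push_cast
    rw [mul_assoc, mul_div_cancel₀ _ (pow_ne_zero k hn'.ne')]
  have hS (d : Fin k) : 0 ≤ ((S d).card : ℝ) / n ∧ ((S d).card : ℝ) / n ≤ 1 := by
    refine ⟨by positivity, (div_le_one hn').2 ?_⟩
    exact_mod_cast (Finset.card_filter_le _ _).trans_eq (Finset.card_range n)
  have herr : |∏ d, ((S d).card : ℝ) / n - ∏ d, (v d - u d)| < k / n := by
    calc _ ≤ ∑ d, |((S d).card : ℝ) / n - (v d - u d)| :=
          abs_prod_sub_prod_le_sum _ _ _ hS fun d =>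
            ⟨sub_nonneg.2 (huv d), by linarith [hu d, hv d]⟩
      _ < ∑ _d : Fin k, 1 / (n : ℝ) :=
          Finset.sum_lt_sum_of_nonempty ⟨⟨0, hk⟩, Finset.mem_univ _⟩ fun d _ =>
            abs_card_filter_div_sub_lt hn (hu d) (huv d) (hv d)
      _ = k / n := by simp [div_eq_mul_inv]
  have hk2 : (k : ℝ) ≤ 2 ^ k - 1 := by
    have : (k : ℝ) + 1 ≤ 2 ^ k := by exact_mod_cast Nat.lt_two_pow_self (n := k)
    linarith
  have hc : (0 : ℝ) < 2 ^ k - 1 := lt_of_lt_of_le (by exact_mod_cast hk) hk2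
  have hpow : (n : ℝ) ^ n = n ^ (n - 1) * n := (pow_sub_one_mul hn.ne' _).symm
  rw [hcount, hprod]
  set P := ∏ d, ((S d).card : ℝ) / n
  set Q := ∏ d, (v d - u d)
  have hε : |n * (P - Q) / (2 ^ k - 1)| < 1 := by
    rw [abs_div, abs_mul, abs_of_pos hn', abs_of_pos hc, div_lt_one hc]
    rw [lt_div_iff₀' hn'] at herr
    exact herr.trans_le hk2
  refine ⟨n * (P - Q) / (2 ^ k - 1), (abs_lt.1 hε).1, (abs_lt.1 hε).2, ?_⟩
  rw [mul_assoc, mul_div_cancel₀ _ hc.ne', hpow]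
  ring
end

section
/- Let k be a positive integer, let ℓ = (l_1, ..., l_k) be a vector of integers such that n does not divide l_d for at least one index d, and let n be an integer with k ≤ n. Let F be an n-ary de Bruijn sequence of order n, viewed as a cyclic sequence of length n^n, and let C be the sequence obtained by dividing each term of F by n. Then the exponential sum ∑_{j=1}^{n^n} e^{2πi (l_1·C_j + l_2·C_{j+1} + ... + l_k·C_{j+k−1})} (indices modulo n^n) equals 0. -/
/-- Summing a function of the windows of a de Bruijn sequence is summing it over all words. -/
theorem IsDeBruijn.sum_windows {M : Type*} [AddCommMonoid M] {b n : ℕ} {f : ℕ → ℕ}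
    (hb : 0 < b) (hf : IsDeBruijn b n f) (G : (Fin n → ℕ) → M) :
    ∑ j ∈ Finset.range (b ^ n), G (fun d => f ((j + d.val) % b ^ n)) =
      ∑ w ∈ Fintype.piFinset (fun _ : Fin n => Finset.range b), G w := by
  rw [← Finset.sum_fiberwise_of_maps_to'
    (t := Fintype.piFinset (fun _ : Fin n => Finset.range b))
    (g := fun j (d : Fin n) => f ((j + d.val) % b ^ n))]
  · refine Finset.sum_congr rfl fun w hw => ?_
    have h := hf.2 w (by simpa using hw)
    simp only [funext_iff, Finset.sum_const, h, one_smul]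
  · intro j _
    simp only [Fintype.mem_piFinset, Finset.mem_range]
    exact fun d => hf.1 _ (Nat.mod_lt _ (pow_pos hb n))

theorem sum_range_exp_eq_zero {n : ℕ} (hn : n ≠ 0) {a : ℤ} (ha : ¬ (n : ℤ) ∣ a) :
    ∑ x ∈ Finset.range n, Complex.exp (2 * Real.pi * Complex.I * (a * ((x : ℂ) / n))) = 0 := by
  have hn' : (n : ℂ) ≠ 0 := Nat.cast_ne_zero.mpr hn
  have hζ := Complex.isPrimitiveRoot_exp n hn
  set ζ := Complex.exp (2 * Real.pi * Complex.I / n) with hζ_def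
  have h1 : ζ ^ a ≠ 1 := fun h => ha ((hζ.zpow_eq_one_iff_dvd a).mp h)
  have hpow : (ζ ^ a) ^ n = 1 := by
    rw [← zpow_natCast, zpow_comm, zpow_natCast, hζ.pow_eq_one, one_zpow]
  have hterm : ∀ x : ℕ,
      Complex.exp (2 * Real.pi * Complex.I * (a * ((x : ℂ) / n))) = (ζ ^ a) ^ x := by
    intro x
    rw [hζ_def, ← Complex.exp_int_mul, ← Complex.exp_nat_mul]
    congr 1
    ring
  simp only [hterm]
  rw [geom_sum_eq h1, hpow, sub_self, zero_div]

theorem stmt6 (k : ℕ) (hk : 1 ≤ k) (l : Fin k → ℤ)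
    (n : ℕ) (hkn : k ≤ n) (hl : ∃ d, ¬ (n : ℤ) ∣ l d)
    (F : ℕ → ℕ) (hF : IsDeBruijn n n F) :
    ∑ j ∈ Finset.range (n ^ n),
      Complex.exp (2 * Real.pi * Complex.I *
        (∑ d : Fin k, (l d : ℂ) * ((F ((j + d.val) % n ^ n) : ℂ) / n))) = 0 := by
  obtain ⟨d₀, hd₀⟩ := hl
  have hn : 0 < n := by omega
  let L : ℕ → ℤ := fun d => if h : d < k then l ⟨d, h⟩ else 0
  have hL : ∀ d : Fin k, l d = L d := fun d => by simp [L]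
  have hsum : ∀ u : ℕ → ℂ, ∑ d : Fin k, (l d : ℂ) * u d = ∑ d : Fin n, (L d : ℂ) * u d := by
    intro u
    simp only [hL]
    rw [Fin.sum_univ_eq_sum_range (fun d => (L d : ℂ) * u d) k,
      Fin.sum_univ_eq_sum_range (fun d => (L d : ℂ) * u d) n]
    refine Finset.sum_subset (Finset.range_mono hkn) fun d _ hd => ?_
    have : ¬ d < k := by simpa using hd
    simp [L, this]
  have hrw : ∀ j : ℕ, ∑ d : Fin k, (l d : ℂ) * ((F ((j + d.val) % n ^ n) : ℂ) / n) =
      ∑ d : Fin n, (L d : ℂ) * ((F ((j + d.val) % n ^ n) : ℂ) / n) :=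
    fun j => hsum fun d => (F ((j + d) % n ^ n) : ℂ) / n
  simp only [hrw]
  rw [hF.sum_windows hn (fun w => Complex.exp (2 * Real.pi * Complex.I *
    ∑ d : Fin n, (L d : ℂ) * ((w d : ℂ) / n)))]
  simp only [Finset.mul_sum, Complex.exp_sum]
  rw [← Finset.prod_univ_sum (fun _ => Finset.range n) (fun (d : Fin n) (x : ℕ) =>
    Complex.exp (2 * Real.pi * Complex.I * ((L d : ℂ) * ((x : ℂ) / n))))]
  refine Finset.prod_eq_zero (Finset.mem_univ (Fin.castLE hkn d₀)) ?_
  refine sum_range_exp_eq_zero hn.ne' ?_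
  simpa [← hL] using hd₀
end

section
/- Let k be a positive integer, let I = [u_1, v_1) × ... × [u_k, v_k) be a box contained in [0,1)^k, and let n be an integer with k ≤ n. Let F be an n-ary de Bruijn sequence of order n, viewed as a cyclic sequence of length n^n, and let C be the sequence obtained by dividing each term of F by n. Then the number of indices i ∈ {1, ..., n^n} such that the cyclic window (C_i, ..., C_{i+k−1}) (indices modulo n^n) lies in I equals n^{n−k} times the number of integer vectors (γ_1, ..., γ_k) ∈ {0, 1, ..., n−1}^k satisfying n·u_d ≤ γ_d < n·v_d for every d = 1, ..., k. -/
/-- The cyclic windows of a de Bruijn sequence satisfying a predicate are as numerous as the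
words satisfying it. -/
theorem IsDeBruijn.card_filter_window {b n : ℕ} {f : ℕ → ℕ} (hf : IsDeBruijn b n f)
    (P : (Fin n → ℕ) → Prop) [DecidablePred P] :
    ((Finset.range (b ^ n)).filter fun i => P fun d => f ((i + d.val) % b ^ n)).card =
      (Finset.univ.filter fun g : Fin n → Fin b => P fun d => (g d : ℕ)).card := by
  obtain ⟨hlt, hex⟩ := hf
  have hwin : ∀ i < b ^ n, ∀ d : Fin n, f ((i + d.val) % b ^ n) < b := fun i hi d =>
    hlt _ (Nat.mod_lt _ (Nat.zero_lt_of_lt hi))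
  refine Finset.card_bij
    (fun i hi d => ⟨f ((i + d.val) % b ^ n),
      hwin i (Finset.mem_range.1 (Finset.mem_filter.1 hi).1) d⟩) ?_ ?_ ?_
  · intro i hi
    simpa using (Finset.mem_filter.1 hi).2
  · intro i hi j hj hij
    rw [Finset.mem_filter, Finset.mem_range] at hi hj
    refine Finset.card_le_one.1 (hex (fun d => f ((j + d.val) % b ^ n)) (hwin j hj.1)).le
      i ?_ j ?_
    · simpa [hi.1] using fun d => congrArg Fin.val (congrFun hij d)
    · simp [hj.1]
  · intro g hg
    obtain ⟨i, hi⟩ := Finset.card_pos.1 ((hex (fun d => g d) fun d => (g d).2).symm ▸ one_pos)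
    obtain ⟨hi, hig⟩ := Finset.mem_filter.1 hi
    refine ⟨i, Finset.mem_filter.2 ⟨hi, ?_⟩, funext fun d => Fin.ext (hig d)⟩
    simpa only [hig] using (Finset.mem_filter.1 hg).2

/-- The number of words of length `n` whose initial part of length `k` satisfies a
predicate. -/
theorem card_filter_castLE {α : Type*} [Fintype α] {k n : ℕ} (h : k ≤ n)
    (P : (Fin k → α) → Prop) [DecidablePred P] :
    (Finset.univ.filter fun g : Fin n → α => P fun d => g (Fin.castLE h d)).card =
      Fintype.card α ^ (n - k) * (Finset.univ.filter P).card := by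
  obtain ⟨m, rfl⟩ := Nat.exists_eq_add_of_le h
  have hcard : (Finset.univ : Finset (Fin m → α)).card = Fintype.card α ^ (k + m - k) := by simp
  rw [← hcard, mul_comm, ← Finset.card_product]
  exact Finset.card_equiv (Fin.appendEquiv k m).symm fun g => by
    simp [Fin.appendEquiv, Fin.castAdd]

theorem stmt8 (k : ℕ) (hk : 1 ≤ k) (u v : Fin k → ℝ)
    (hu : ∀ d, 0 ≤ u d) (huv : ∀ d, u d ≤ v d) (hv : ∀ d, v d ≤ 1)
    (n : ℕ) (hkn : k ≤ n) (F : ℕ → ℕ) (hF : IsDeBruijn n n F) :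
    ((Finset.range (n ^ n)).filter (fun i => ∀ d : Fin k,
        u d ≤ (F ((i + d.val) % n ^ n) : ℝ) / n ∧
          (F ((i + d.val) % n ^ n) : ℝ) / n < v d)).card
      = n ^ (n - k) * (Finset.univ.filter (fun γ : Fin k → Fin n => ∀ d,
          (n : ℝ) * u d ≤ ((γ d : ℕ) : ℝ) ∧ ((γ d : ℕ) : ℝ) < (n : ℝ) * v d)).card := by
  have hn : (0 : ℝ) < n := by exact_mod_cast hk.trans hkn
  simp only [le_div_iff₀' hn, div_lt_iff₀' hn]
  have hwindow := hF.card_filter_window fun w => ∀ d : Fin k,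
    (n : ℝ) * u d ≤ w (Fin.castLE hkn d) ∧ (w (Fin.castLE hkn d) : ℝ) < n * v d
  have hinit := card_filter_castLE hkn fun γ : Fin k → Fin n => ∀ d,
    (n : ℝ) * u d ≤ ((γ d : ℕ) : ℝ) ∧ ((γ d : ℕ) : ℝ) < (n : ℝ) * v d
  rw [Fintype.card_fin] at hinit
  exact hwindow.trans hinit
end
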